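/- Let ψ : (ℕ →₀ k[t]) → (ℕ →₀ k[t]) be the k-linear map with ψ(single_i(P)) = single_i(T_{−λ}(P)) − single_{i−1}(P(t−λ) · T_{iλ}(u)) for i ≥ 1 and ψ(single_0(P)) = single_0(T_{−λ}(P)); this is the e₁-component of the vertical map φ₁ of the double complex W_{**}(E) of the paper on the summand ⊕_{i≥0} A x^i y^i e₁e₂. Then ψ(𝔙_n) = 0 for every n ≥ 0; equivalently, φ₁(𝔙_n) lies in ⊕_{i≥0} A x^i y^i and equals −T_λ(u') x^n y^n − Σ_{j=0}^{n−1} 𝔘_{j−1}^{n−1}(t+λ) T_λ(u') x^j y^j. (The identity for φ₁(𝔙_n) established in the proof of Theorem 2.2.8.) -/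

import Mathlib

open Polynomial

/-- `T μ P = P(t+μ) − P(t)`, the difference operator of Section 2.2 of
Guccione–Guccione, "Hochschild homology of iterated skew polynomial rings". -/
noncomputable def Tdiff {k : Type*} [Field k] (μ : k) (P : k[X]) : k[X] :=
  P.comp (X + C μ) - P

open scoped Classical in
/-- `𝔘_j^n = (−1)^{n−j} Σ_{0 ≤ i₁ ≤ ⋯ ≤ i_{n−j} ≤ j+1} u(t+i₁λ)⋯u(t+i_{n−j}λ)`,
the sum running over weakly increasing sequences of `n−j` integers between `0`
and `j+1` (so `𝔘_n^n = 1`). -/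
noncomputable def Ufrak {k : Type*} [Field k] (u : k[X]) (lam : k) (n : ℕ) (j : ℤ) : k[X] :=
  (-1) ^ (((n : ℤ) - j).toNat) *
    ∑ f ∈ Finset.univ.filter
        (fun f : Fin (((n : ℤ) - j).toNat) → Fin ((j + 2).toNat) => Monotone f),
      ∏ l, u.comp (X + C (((f l : ℕ) : k) * lam))

/-- `𝔙_n = x^n y^n e₁e₂ + Σ_{j=0}^{n−1} 𝔘_{j−1}^{n−1}(t+λ) x^j y^j e₁e₂`,
modelled in `ℕ →₀ k[t]`. -/
noncomputable def Vfrak {k : Type*} [Field k] (u : k[X]) (lam : k) (n : ℕ) :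
    ℕ →₀ k[X] :=
  Finsupp.single n 1 +
    ∑ j ∈ Finset.range n,
      Finsupp.single j ((Ufrak u lam (n - 1) ((j : ℤ) - 1)).comp (X + C lam))

open scoped Classical in
/-- Complete homogeneous symmetric sums via monotone maps. -/
noncomputable def Hsum {R : Type*} [CommRing R] (m r : ℕ) (g : ℕ → R) : R :=
  ∑ f ∈ Finset.univ.filter (fun f : Fin m → Fin r => Monotone f), ∏ l, g (f l : ℕ)

theorem Hsum_zero {R : Type*} [CommRing R] (r : ℕ) (g : ℕ → R) : Hsum 0 r g = 1 := by
  classical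
  unfold Hsum
  rw [Finset.filter_true_of_mem]
  · simp
  · intro f _ a
    exact a.elim0

theorem Hsum_first {R : Type*} [CommRing R] (m r : ℕ) (g : ℕ → R) :
    Hsum (m + 1) (r + 1) g = Hsum (m + 1) r (fun i => g (i + 1)) + g 0 * Hsum m (r + 1) g := by
  classical
  unfold Hsum
  rw [← Finset.sum_filter_not_add_sum_filter _
    (fun f : Fin (m + 1) → Fin (r + 1) => f 0 = 0)]
  congr 1
  · symm
    refine Finset.sum_nbij (fun f l => (f l).succ) ?_ ?_ ?_ ?_
    · intro f hf
      simp only [Finset.mem_filter, Finset.mem_univ, true_and] at hf ⊢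
      refine ⟨fun a b hab => Fin.succ_le_succ_iff.2 (hf hab), Fin.succ_ne_zero _⟩
    · intro f _ f' _ h
      funext l
      exact Fin.succ_injective _ (congrFun h l)
    · intro f hf
      simp only [Finset.coe_filter, Finset.mem_filter, Finset.mem_univ, true_and,
        Set.mem_setOf_eq] at hf
      obtain ⟨hm, h0⟩ := hf
      have hne : ∀ l, f l ≠ 0 := by
        intro l hl
        have := hm (Fin.zero_le l)
        rw [hl] at this
        exact h0 (Fin.le_zero_iff.1 this)
      refine ⟨fun l => (f l).pred (hne l), ?_, ?_⟩
      · simp only [Finset.coe_filter, Finset.mem_univ, true_and, Set.mem_setOf_eq]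
        intro a b hab
        exact Fin.pred_le_pred_iff.2 (hm hab)
      · funext l
        simp
    · intro f _
      simp
  · rw [Finset.mul_sum]
    symm
    refine Finset.sum_nbij (fun f => (Fin.cons 0 f : Fin (m + 1) → Fin (r + 1))) ?_ ?_ ?_ ?_
    · intro f hf
      simp only [Finset.mem_filter, Finset.mem_univ, true_and] at hf ⊢
      refine ⟨fun a b => ?_, by simp⟩
      refine Fin.cases ?_ (fun a => ?_) a
      · intro _
        simp
      · refine Fin.cases ?_ (fun b => ?_) b
        · intro h
          exact absurd (Fin.le_zero_iff.1 h) (Fin.succ_ne_zero _)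
        · intro h
          simpa using hf (Fin.succ_le_succ_iff.1 h)
    · intro f _ f' _ h
      exact Fin.cons_right_injective _ h
    · intro f hf
      simp only [Finset.coe_filter, Finset.mem_filter, Finset.mem_univ, true_and,
        Set.mem_setOf_eq] at hf
      obtain ⟨hm, h0⟩ := hf
      refine ⟨fun l => f l.succ, ?_, ?_⟩
      · simp only [Finset.coe_filter, Finset.mem_univ, true_and, Set.mem_setOf_eq]
        intro a b hab
        exact hm (Fin.succ_le_succ_iff.2 hab)
      · funext l
        refine Fin.cases ?_ (fun a => ?_) l
        · simp [h0]
        · simp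
    · intro f _
      simp [Fin.prod_univ_succ]

theorem Hsum_last {R : Type*} [CommRing R] (m r : ℕ) (g : ℕ → R) :
    Hsum (m + 1) (r + 1) g = Hsum (m + 1) r g + g r * Hsum m (r + 1) g := by
  classical
  unfold Hsum
  rw [← Finset.sum_filter_not_add_sum_filter _
    (fun f : Fin (m + 1) → Fin (r + 1) => f (Fin.last m) = Fin.last r)]
  congr 1
  · symm
    refine Finset.sum_nbij (fun f l => (f l).castSucc) ?_ ?_ ?_ ?_
    · intro f hf
      simp only [Finset.mem_filter, Finset.mem_univ, true_and] at hf ⊢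
      refine ⟨fun a b hab => Fin.castSucc_le_castSucc_iff.2 (hf hab), Fin.castSucc_ne_last _⟩
    · intro f _ f' _ h
      funext l
      exact Fin.castSucc_injective _ (congrFun h l)
    · intro f hf
      simp only [Finset.coe_filter, Finset.mem_filter, Finset.mem_univ, true_and,
        Set.mem_setOf_eq] at hf
      obtain ⟨hm, h0⟩ := hf
      have hne : ∀ l, f l ≠ Fin.last r := by
        intro l hl
        have := hm (Fin.le_last l)
        rw [hl] at this
        exact h0 (Fin.last_le_iff.1 this)
      refine ⟨fun l => (f l).castPred (hne l), ?_, ?_⟩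
      · simp only [Finset.coe_filter, Finset.mem_univ, true_and, Set.mem_setOf_eq]
        intro a b hab
        exact Fin.castPred_le_castPred_iff.2 (hm hab)
      · funext l
        simp
    · intro f _
      simp
  · rw [Finset.mul_sum]
    symm
    refine Finset.sum_nbij
      (fun f => (Fin.snoc f (Fin.last r) : Fin (m + 1) → Fin (r + 1))) ?_ ?_ ?_ ?_
    · intro f hf
      simp only [Finset.mem_filter, Finset.mem_univ, true_and] at hf ⊢
      refine ⟨fun a b => ?_, by simp⟩
      refine Fin.lastCases ?_ (fun b => ?_) b
      · intro _
        simp [Fin.le_last]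
      · refine Fin.lastCases ?_ (fun a => ?_) a
        · intro h
          exact absurd (Fin.last_le_iff.1 h) (Fin.castSucc_ne_last _)
        · intro h
          simpa using hf (Fin.castSucc_le_castSucc_iff.1 h)
    · intro f _ f' _ h
      funext l
      simpa using congrFun h l.castSucc
    · intro f hf
      simp only [Finset.coe_filter, Finset.mem_filter, Finset.mem_univ, true_and,
        Set.mem_setOf_eq] at hf
      obtain ⟨hm, h0⟩ := hf
      refine ⟨fun l => f l.castSucc, ?_, ?_⟩
      · simp only [Finset.coe_filter, Finset.mem_univ, true_and, Set.mem_setOf_eq]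
        intro a b hab
        exact hm (Fin.castSucc_le_castSucc_iff.2 hab)
      · funext l
        refine Fin.lastCases ?_ (fun a => ?_) l
        · simp [h0]
        · simp
    · intro f _
      simp [Fin.prod_univ_castSucc, mul_comm]

theorem Hsum_comp {k : Type*} [Field k] (m r : ℕ) (g : ℕ → k[X]) (q : k[X]) :
    (Hsum m r g).comp q = Hsum m r (fun i => (g i).comp q) := by
  unfold Hsum
  simp only [← Polynomial.coe_compRingHom_apply, map_sum, map_prod]

theorem Ufrak_eq {k : Type*} [Field k] (u : k[X]) (lam : k) (n : ℕ) (j : ℤ) (m r : ℕ)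
    (hm : ((n : ℤ) - j).toNat = m) (hr : (j + 2).toNat = r) :
    Ufrak u lam n j = (-1) ^ m * Hsum m r (fun i => u.comp (X + C ((i : k) * lam))) := by
  subst hm hr
  rfl

/-- The coefficients of `𝔙_n`. -/
noncomputable def cco {k : Type*} [Field k] (u : k[X]) (lam : k) (n j : ℕ) : k[X] :=
  (-1) ^ (n - j) * Hsum (n - j) (j + 1) (fun i => u.comp (X + C (((i : k) + 1) * lam)))

theorem Vfrak_eq {k : Type*} [Field k] (u : k[X]) (lam : k) (n : ℕ) :
    Vfrak u lam n = ∑ j ∈ Finset.range (n + 1), Finsupp.single j (cco u lam n j) := by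
  rw [Finset.sum_range_succ, add_comm]
  unfold Vfrak
  congr 1
  · simp [cco, Hsum_zero]
  · refine Finset.sum_congr rfl fun j hj => ?_
    have hj := Finset.mem_range.1 hj
    rw [Ufrak_eq u lam (n - 1) ((j : ℤ) - 1) (n - j) (j + 1) (by omega) (by omega), cco,
      mul_comp, Hsum_comp]
    congr 2
    · simp
    · congr 1
      funext i
      rw [comp_assoc]
      congr 1
      simp only [add_comp, X_comp, C_comp, add_mul, one_mul, C_add]
      ring

theorem cco_shift {k : Type*} [Field k] (u : k[X]) (lam : k) (n j : ℕ) :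
    (cco u lam n j).comp (X - C lam) =
      (-1) ^ (n - j) * Hsum (n - j) (j + 1) (fun i => u.comp (X + C ((i : k) * lam))) := by
  rw [cco, mul_comp, Hsum_comp]
  congr 1
  · simp
  · congr 1
    funext i
    rw [comp_assoc]
    congr 1
    simp only [add_comp, X_comp, C_comp, add_mul, one_mul, C_add]
    ring

theorem cco_rec {k : Type*} [Field k] (u : k[X]) (lam : k) (n j : ℕ) (hj : j < n) :
    Tdiff (-lam) (cco u lam n j) =
      (cco u lam n (j + 1)).comp (X - C lam) * Tdiff (((j : k) + 1) * lam) u := by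
  obtain ⟨d, rfl⟩ : ∃ d, n = j + 1 + d := ⟨n - (j + 1), by omega⟩
  have e1 : j + 1 + d - j = d + 1 := by omega
  have e2 : j + 1 + d - (j + 1) = d := by omega
  have h1 := Hsum_first d (j + 1) (fun i => u.comp (X + C ((i : k) * lam)))
  have h2 := Hsum_last d (j + 1) (fun i => u.comp (X + C ((i : k) * lam)))
  rw [h1] at h2
  unfold Tdiff
  rw [C_neg, ← sub_eq_add_neg, cco_shift, cco_shift, cco, e1, e2]
  simp only [Nat.cast_add, Nat.cast_one, Nat.cast_zero, zero_mul, C_0, add_zero, comp_X] at h2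
  linear_combination (-1) ^ (d + 1) * (-h2)

/-- The identity `ψ(𝔙_n) = 0` (equivalently, `φ₁(𝔙_n) ∈ ⊕_{i≥0} A x^i y^i`)
established in the proof of Theorem 2.2.8 of Guccione–Guccione, where `ψ` is
the `e₁`-component of the vertical map `φ₁` of `W_{**}(E)` on the summand
`⊕_{i≥0} A x^i y^i e₁e₂`. -/
theorem stmt16 {k : Type*} [Field k] [CharZero k] (lam : k) (hlam : lam ≠ 0)
    (u : k[X])
    (Ψ : (ℕ →₀ k[X]) →ₗ[k] (ℕ →₀ k[X]))
    (hΨ0 : ∀ P : k[X], Ψ (Finsupp.single 0 P) = Finsupp.single 0 (Tdiff (-lam) P))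
    (hΨ : ∀ (i : ℕ) (P : k[X]),
      Ψ (Finsupp.single (i + 1) P) =
        Finsupp.single (i + 1) (Tdiff (-lam) P) -
          Finsupp.single i (P.comp (X - C lam) * Tdiff (((i : k) + 1) * lam) u)) :
    ∀ n : ℕ, Ψ (Vfrak u lam n) = 0 := by
  intro n
  rw [Vfrak_eq, map_sum, Finset.sum_range_succ', hΨ0]
  simp only [hΨ, Finset.sum_sub_distrib]
  have h := Finset.sum_range_succ' (fun j => Finsupp.single j (Tdiff (-lam) (cco u lam n j))) n
  rw [Finset.sum_range_succ] at h
  have hn : Tdiff (-lam) (cco u lam n n) = 0 := by simp [Tdiff, cco, Hsum_zero]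
  rw [hn, Finsupp.single_zero, add_zero] at h
  rw [sub_add_eq_add_sub, ← h, ← Finset.sum_sub_distrib]
  refine Finset.sum_eq_zero fun j hj => ?_
  rw [cco_rec u lam n j (Finset.mem_range.1 hj), sub_self]
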